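/- Let l, n, m be positive integers and let α, β be integers with |α| ≤ n and |β| ≤ m. If l·α² - α·β = l·n² + n·m, then (α, β) = (n, -m) or (α, β) = (-n, m); in particular |α| = n, |β| = m, and α·β = -n·m < 0. -/

import Mathlib

theorem quadratic_form_max_eq_case (l n m : ℤ) (hl : 0 < l) (hn : 0 < n) (hm : 0 < m)
    (α β : ℤ) (hα : |α| ≤ n) (hβ : |β| ≤ m)
    (heq : l * α ^ 2 - α * β = l * n ^ 2 + n * m) :
    ((α, β) = (n, -m) ∨ (α, β) = (-n, m)) ∧
      |α| = n ∧ |β| = m ∧ α * β = -(n * m) ∧ α * β < 0 := by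
  have hsq : α ^ 2 ≤ n ^ 2 := sq_le_sq.mpr (hα.trans (le_abs_self n))
  have hmul : -(α * β) ≤ n * m :=
    calc -(α * β) ≤ |α * β| := neg_le_abs _
      _ = |α| * |β| := abs_mul α β
      _ ≤ n * m := mul_le_mul hα hβ (abs_nonneg β) hn.le
  have hle : l * n ^ 2 ≤ l * α ^ 2 := by linarith
  have hsq_eq : α ^ 2 = n ^ 2 := le_antisymm hsq (le_of_mul_le_mul_left hle hl)
  have hprod : α * β = -(n * m) := by
    rw [hsq_eq] at heq
    linarith
  have hneg : α * β < 0 := by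
    rw [hprod]
    exact neg_neg_of_pos (mul_pos hn hm)
  rcases sq_eq_sq_iff_eq_or_eq_neg.mp hsq_eq with rfl | rfl
  · obtain rfl : β = -m := mul_left_cancel₀ hn.ne' (by linarith)
    exact ⟨Or.inl rfl, abs_of_pos hn, by rw [abs_neg, abs_of_pos hm], hprod, hneg⟩
  · obtain rfl : β = m := mul_left_cancel₀ hn.ne' (by linarith)
    exact ⟨Or.inr rfl, by rw [abs_neg, abs_of_pos hn], abs_of_pos hm, hprod, hneg⟩
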